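/- arXiv:2509.13609 — 6 statements merged into one kernel-verified Lean document; each statement's English description precedes it below -/
import Mathlib

section
/- Let n ≥ 0 and let A, B, C be positive semidefinite Hermitian (n+1)×(n+1) complex matrices whose determinants (which are nonnegative real numbers) satisfy det A > det C and det B ≥ det C. Then for every θ ∈ (0,1), det(θ·A + (1−θ)·B) ≥ det C + ( θ·((det A)^{1/(n+1)} − (det C)^{1/(n+1)}) )^{n+1}; in particular det(θ·A + (1−θ)·B) > det C. -/
open ComplexOrder

/-- Superadditivity of the geometric mean on nonnegative families, with `1` as one summand. -/
theorem Real.one_add_prod_rpow_le_prod_one_add_rpow {ι : Type*} [Fintype ι] [Nonempty ι]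
    (x : ι → ℝ) (hx : ∀ i, 0 ≤ x i) :
    1 + (∏ i, x i) ^ (1 / (Fintype.card ι : ℝ)) ≤
      (∏ i, (1 + x i)) ^ (1 / (Fintype.card ι : ℝ)) := by
  set m : ℝ := (Fintype.card ι : ℝ)
  have hm : 0 < m := by simp only [m]; exact_mod_cast Fintype.card_pos
  have hpos : ∀ i, 0 < 1 + x i := fun i => by linarith [hx i]
  have hprod : 0 < ∏ i, (1 + x i) := Finset.prod_pos fun i _ => hpos i
  have amgm : ∀ z : ι → ℝ, (∀ i, 0 ≤ z i) → (∏ i, z i) ^ (1 / m) ≤ ∑ i, 1 / m * z i := by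
    intro z hz
    rw [← Real.finsetProd_rpow _ _ fun i _ => hz i]
    refine Real.geom_mean_le_arith_mean_weighted _ _ _ (fun _ _ => by positivity) ?_
      fun i _ => hz i
    simp only [Finset.sum_const, Finset.card_univ, nsmul_eq_mul]
    exact mul_one_div_cancel hm.ne'
  have h₁ := amgm (fun i => 1 / (1 + x i)) fun i => (one_div_pos.2 (hpos i)).le
  have h₂ := amgm (fun i => x i / (1 + x i)) fun i => div_nonneg (hx i) (hpos i).le
  have hsum : ∑ i, 1 / m * (1 / (1 + x i)) + ∑ i, 1 / m * (x i / (1 + x i)) = 1 := by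
    rw [← Finset.sum_add_distrib]
    calc ∑ i, (1 / m * (1 / (1 + x i)) + 1 / m * (x i / (1 + x i)))
        = ∑ _i : ι, 1 / m := Finset.sum_congr rfl fun i _ => by
          have := (hpos i).ne'
          field_simp
      _ = 1 := by
        simp only [Finset.sum_const, Finset.card_univ, nsmul_eq_mul]
        exact mul_one_div_cancel hm.ne'
  rw [Finset.prod_div_distrib, Real.div_rpow (by simp) hprod.le] at h₁
  rw [Finset.prod_div_distrib,
    Real.div_rpow (Finset.prod_nonneg fun i _ => hx i) hprod.le] at h₂
  simp only [Finset.prod_const_one, Real.one_rpow] at h₁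
  have hle := (add_le_add h₁ h₂).trans_eq hsum
  rwa [← add_div, div_le_one (Real.rpow_pos_of_pos hprod _)] at hle

namespace Matrix

variable {ι : Type*} [Fintype ι] [DecidableEq ι]

theorem IsHermitian.det_one_add_eq_prod {M : Matrix ι ι ℂ} (hM : M.IsHermitian) :
    (1 + M).det = ∏ i, (1 + (hM.eigenvalues i : ℂ)) := by
  have h := congrArg (Polynomial.eval (-1)) hM.charpoly_eq
  rw [eval_charpoly, Polynomial.eval_prod] at h
  have hneg : scalar ι (-1 : ℂ) - M = -(1 + M) := by
    rw [map_neg, map_one, neg_add, sub_eq_add_neg]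
  rw [hneg, det_neg] at h
  have hr : ∀ i, Polynomial.eval (-1) (Polynomial.X - Polynomial.C (hM.eigenvalues i : ℂ)) =
      -1 * (1 + (hM.eigenvalues i : ℂ)) := fun i => by simp; ring
  simp only [RCLike.ofReal_eq_complex_ofReal] at h
  rw [Finset.prod_congr rfl fun i _ => hr i, Finset.prod_mul_distrib, Finset.prod_const,
    Finset.card_univ] at h
  exact mul_left_cancel₀ (pow_ne_zero _ (by norm_num)) h

theorem PosSemidef.det_im {M : Matrix ι ι ℂ} (hM : M.PosSemidef) : M.det.im = 0 :=
  (Complex.nonneg_iff.1 hM.det_nonneg).2.symm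

theorem PosSemidef.one_add_det_rpow_le [Nonempty ι] {M : Matrix ι ι ℂ} (hM : M.PosSemidef) :
    1 + M.det.re ^ (1 / (Fintype.card ι : ℝ)) ≤
      (1 + M).det.re ^ (1 / (Fintype.card ι : ℝ)) := by
  have h₁ : M.det = ((∏ i, hM.1.eigenvalues i : ℝ) : ℂ) := by
    rw [hM.1.det_eq_prod_eigenvalues]; push_cast; rfl
  have h₂ : (1 + M).det = ((∏ i, (1 + hM.1.eigenvalues i) : ℝ) : ℂ) := by
    rw [hM.1.det_one_add_eq_prod]; push_cast; rfl
  rw [h₁, h₂, Complex.ofReal_re, Complex.ofReal_re]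
  exact Real.one_add_prod_rpow_le_prod_one_add_rpow _ hM.eigenvalues_nonneg

open scoped MatrixOrder in
/-- **Minkowski's determinant inequality**, with one of the summands positive definite. -/
theorem PosDef.det_rpow_add_det_rpow_le [Nonempty ι] {A B : Matrix ι ι ℂ}
    (hA : A.PosDef) (hB : B.PosSemidef) :
    A.det.re ^ (1 / (Fintype.card ι : ℝ)) + B.det.re ^ (1 / (Fintype.card ι : ℝ)) ≤
      (A + B).det.re ^ (1 / (Fintype.card ι : ℝ)) := by
  obtain ⟨S, hS⟩ := CStarAlgebra.nonneg_iff_eq_star_mul_self.mp hA.posSemidef.nonneg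
  rw [star_eq_conjTranspose] at hS
  have hSu : IsUnit S.det := by
    have h : A.det ≠ 0 := hA.det_pos.ne'
    rw [hS, det_mul] at h
    exact (right_ne_zero_of_mul h).isUnit
  have hM : (S⁻¹ᴴ * B * S⁻¹).PosSemidef := hB.conjTranspose_mul_mul_same _
  set M := S⁻¹ᴴ * B * S⁻¹
  have hBM : B = Sᴴ * M * S := by
    have h₁ : Sᴴ * S⁻¹ᴴ = 1 := by
      rw [← conjTranspose_mul, nonsing_inv_mul _ hSu, conjTranspose_one]
    calc B = (Sᴴ * S⁻¹ᴴ) * B * (S⁻¹ * S) := by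
          rw [h₁, nonsing_inv_mul _ hSu, Matrix.one_mul, Matrix.mul_one]
      _ = Sᴴ * M * S := by simp only [M, Matrix.mul_assoc]
  have hAB : A + B = Sᴴ * (1 + M) * S := by
    rw [hBM, hS, Matrix.mul_add, Matrix.add_mul, Matrix.mul_one]
  have hdet : ∀ N : Matrix ι ι ℂ, (Sᴴ * N * S).det.re = A.det.re * N.det.re := by
    intro N
    have : (Sᴴ * N * S).det = A.det * N.det := by
      rw [hS]; simp only [det_mul]; ring
    rw [this, Complex.mul_re, hA.posSemidef.det_im, zero_mul, sub_zero]
  have hA₀ : 0 ≤ A.det.re := (Complex.nonneg_iff.1 hA.posSemidef.det_nonneg).1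
  rw [hAB, hdet, hBM, hdet, Real.mul_rpow hA₀ (Complex.nonneg_iff.1 hM.det_nonneg).1,
    Real.mul_rpow hA₀ (Complex.nonneg_iff.1 (PosSemidef.one.add hM).det_nonneg).1]
  calc _ = A.det.re ^ (1 / (Fintype.card ι : ℝ)) *
        (1 + M.det.re ^ (1 / (Fintype.card ι : ℝ))) := by ring
    _ ≤ _ := mul_le_mul_of_nonneg_left hM.one_add_det_rpow_le (Real.rpow_nonneg hA₀ _)

theorem det_ofReal_smul_re (t : ℝ) (A : Matrix ι ι ℂ) :
    ((t : ℂ) • A).det.re = t ^ Fintype.card ι * A.det.re := by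
  rw [det_smul, ← Complex.ofReal_pow, Complex.re_ofReal_mul]

end Matrix

/-- **Lemma 4.3 of the paper.**  Let `A`, `B`, `C` be positive semidefinite Hermitian
`(n+1) × (n+1)` complex matrices with `det A > det C` and `det B ≥ det C` (their
determinants being nonnegative real numbers).  Then for every `θ ∈ (0,1)`,
`det (θ•A + (1-θ)•B) ≥ det C + (θ·((det A)^(1/(n+1)) - (det C)^(1/(n+1))))^(n+1)`,
and in particular `det (θ•A + (1-θ)•B) > det C`. -/
theorem stmt_0 (n : ℕ) (A B C : Matrix (Fin (n+1)) (Fin (n+1)) ℂ)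
    (hA : A.PosSemidef) (hB : B.PosSemidef) (hC : C.PosSemidef)
    (hAC : C.det.re < A.det.re) (hBC : C.det.re ≤ B.det.re) :
    ∀ θ : ℝ, θ ∈ Set.Ioo (0:ℝ) 1 →
      C.det.re +
          (θ * (A.det.re ^ ((1:ℝ)/(n+1)) - C.det.re ^ ((1:ℝ)/(n+1)))) ^ (n+1)
        ≤ (((θ:ℂ) • A + (((1-θ:ℝ)):ℂ) • B).det).re ∧
      C.det.re < (((θ:ℂ) • A + (((1-θ:ℝ)):ℂ) • B).det).re := by
  rintro θ ⟨hθ₀, hθ₁⟩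
  have hC₀ : 0 ≤ C.det.re := (Complex.nonneg_iff.1 hC.det_nonneg).1
  have hA₀ : 0 < A.det.re := hC₀.trans_lt hAC
  have hB₀ : 0 ≤ B.det.re := hC₀.trans hBC
  have hApd : A.PosDef := hA.posDef_iff_det_ne_zero.2 fun h => by simp [h] at hA₀
  have hφ₀ : 0 < 1 - θ := sub_pos.2 hθ₁
  have hA' : ((θ : ℂ) • A).PosDef := hApd.smul (by exact_mod_cast hθ₀)
  have hB' : (((1 - θ : ℝ) : ℂ) • B).PosSemidef := hB.smul (by exact_mod_cast hφ₀.le)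
  have hD₀ := (Complex.nonneg_iff.1 (hA'.posSemidef.add hB').det_nonneg).1
  have hmink := hA'.det_rpow_add_det_rpow_le hB'
  have hroot : ∀ x : ℝ, 0 ≤ x → (x ^ (n + 1)) ^ ((1 : ℝ) / (n + 1)) = x := fun x hx => by
    simpa using Real.pow_rpow_inv_natCast hx n.succ_ne_zero
  have hpow : ∀ x : ℝ, 0 ≤ x → (x ^ ((1 : ℝ) / (n + 1))) ^ (n + 1) = x := fun x hx => by
    simpa using Real.rpow_inv_natCast_pow hx n.succ_ne_zero
  rw [Matrix.det_ofReal_smul_re, Matrix.det_ofReal_smul_re, Fintype.card_fin, Nat.cast_add,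
    Nat.cast_one, Real.mul_rpow (by positivity) hA₀.le, Real.mul_rpow (by positivity) hB₀,
    hroot θ hθ₀.le, hroot _ hφ₀.le] at hmink
  have hexp : (0 : ℝ) < 1 / (n + 1) := by positivity
  have hac := Real.rpow_lt_rpow hC₀ hAC hexp
  have hbc := Real.rpow_le_rpow hC₀ hBC hexp.le
  set D := ((θ : ℂ) • A + ((1 - θ : ℝ) : ℂ) • B).det.re
  set a := A.det.re ^ ((1 : ℝ) / (n + 1))
  set b := B.det.re ^ ((1 : ℝ) / (n + 1))
  have hc₀ : 0 ≤ C.det.re ^ ((1 : ℝ) / (n + 1)) := Real.rpow_nonneg hC₀ _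
  have hcC := hpow _ hC₀
  set c := C.det.re ^ ((1 : ℝ) / (n + 1))
  have hx : 0 < θ * (a - c) := mul_pos hθ₀ (sub_pos.2 hac)
  have hmain : C.det.re + (θ * (a - c)) ^ (n + 1) ≤ D :=
    calc C.det.re + (θ * (a - c)) ^ (n + 1) = c ^ (n + 1) + (θ * (a - c)) ^ (n + 1) := by rw [hcC]
      _ ≤ (c + θ * (a - c)) ^ (n + 1) := pow_add_pow_le hc₀ hx.le n.succ_ne_zero
      _ ≤ (D ^ ((1 : ℝ) / (n + 1))) ^ (n + 1) := by
        refine pow_le_pow_left₀ (add_nonneg hc₀ hx.le) (le_trans ?_ hmink) _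
        nlinarith [mul_le_mul_of_nonneg_left hbc hφ₀.le]
      _ = D := hpow _ hD₀
  exact ⟨hmain, (lt_add_of_pos_right _ (pow_pos hx _)).trans_le hmain⟩
end

section
/- Let m ≥ 1 and let u : ℝ^m → ℝ be continuous and bounded above. Then there exists a sequence (x_k)_{k≥1} of points of ℝ^m such that u(x_k) → sup_{x ∈ ℝ^m} u(x) as k → ∞, and for every k ≥ 1 and every x ∈ ℝ^m one has u(x) ≤ u(x_k) + (1/k)·( |x − x_k| + |x − x_k|² ). -/
open Filter

/-- A continuous function bounded above on a proper space, penalized by a positive multiple of the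
norm, attains its maximum. -/
theorem Continuous.exists_forall_sub_mul_norm_le {E : Type*} [NormedAddCommGroup E] [ProperSpace E]
    {u : E → ℝ} (hu : Continuous u) (hbd : BddAbove (Set.range u)) {ε : ℝ} (hε : 0 < ε) :
    ∃ x, ∀ y, u y - ε * ‖y‖ ≤ u x - ε * ‖x‖ := by
  obtain ⟨M, hM⟩ := hbd
  refine Continuous.exists_forall_ge (f := fun y => u y - ε * ‖y‖) (by fun_prop) ?_
  simp only [sub_eq_add_neg]
  exact tendsto_atBot_add_left_of_ge _ M (fun y => hM ⟨y, rfl⟩)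
    (tendsto_neg_atTop_atBot.comp ((tendsto_norm_cocompact_atTop (E := E)).const_mul_atTop hε))

/-- Euclidean core of the paper's Lemma 4.2 (a Wu–Yau-type maximal principle for
continuous functions bounded above): for a continuous function `u : ℝ^m → ℝ` bounded
above there is a sequence `x_k` with `u (x_k) → sup u` and, for every `k ≥ 1` and
every `x`, `u x ≤ u (x_k) + (1/k) · (‖x - x_k‖ + ‖x - x_k‖²)`. -/
theorem stmt_2 (m : ℕ) (hm : 1 ≤ m)
    (u : EuclideanSpace ℝ (Fin m) → ℝ) (hu : Continuous u)
    (hbd : BddAbove (Set.range u)) :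
    ∃ x : ℕ → EuclideanSpace ℝ (Fin m),
      Tendsto (fun k => u (x k)) atTop (nhds (⨆ y, u y)) ∧
      ∀ k : ℕ, 1 ≤ k → ∀ y : EuclideanSpace ℝ (Fin m),
        u y ≤ u (x k) + (1/(k:ℝ)) * (‖y - x k‖ + ‖y - x k‖^2) := by
  have hmax : ∀ k : ℕ, ∃ x, 1 ≤ k → ∀ y, u y - 1 / (k : ℝ) * ‖y‖ ≤ u x - 1 / (k : ℝ) * ‖x‖ := by
    intro k
    by_cases hk : 1 ≤ k
    · obtain ⟨x, hx⟩ := hu.exists_forall_sub_mul_norm_le hbd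
        (one_div_pos.mpr (Nat.cast_pos.mpr hk : (0 : ℝ) < k))
      exact ⟨x, fun _ => hx⟩
    · exact ⟨0, fun h => absurd h hk⟩
  choose x hx using hmax
  refine ⟨x, tendsto_order.mpr ⟨fun a ha => ?_, fun a ha => ?_⟩, fun k hk y => ?_⟩
  · obtain ⟨y, hy⟩ := exists_lt_of_lt_ciSup ha
    have hlim : Tendsto (fun k : ℕ => u y - 1 / (k : ℝ) * ‖y‖) atTop (nhds (u y)) := by
      simpa using (tendsto_one_div_atTop_nhds_zero_nat (𝕜 := ℝ)).mul_const ‖y‖ |>.const_sub (u y)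
    filter_upwards [hlim.eventually_const_lt hy, eventually_ge_atTop 1] with k hlt hk
    have hnonneg : 0 ≤ 1 / (k : ℝ) * ‖x k‖ := by positivity
    linarith [hx k hk y]
  · exact Eventually.of_forall fun k => (le_ciSup hbd (x k)).trans_lt ha
  · have hnorm : ‖y‖ - ‖x k‖ ≤ ‖y - x k‖ + ‖y - x k‖ ^ 2 := by
      linarith [norm_sub_norm_le y (x k), sq_nonneg ‖y - x k‖]
    have hscaled := mul_le_mul_of_nonneg_left hnorm (by positivity : 0 ≤ 1 / (k : ℝ))
    linarith [hx k hk y]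
end

section
/- Let α ∈ (0,1), K ≥ 0, and let f : ℝ → ℝ be 2π-periodic and α-Hölder with constant K. Then for every ξ ∈ ℝ, the principal-value limit Hf(ξ) = (1/π) · lim_{ε→0⁺} ∫_{ε ≤ |θ| ≤ π} cot(θ/2)·f(ξ − θ) dθ exists, and |Hf(ξ)| ≤ (8/α)·K. -/
open MeasureTheory

/-- `IsHilbertTransformAt f ξ L` says that the principal value
`(1/π) · lim_{ε→0⁺} ∫_{ε ≤ |θ| ≤ π} cot(θ/2)·f(ξ - θ) dθ` exists and equals `L`;
i.e. `L` is the value of the (circle) Hilbert transform of `f` at `ξ`. -/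
def IsHilbertTransformAt (f : ℝ → ℝ) (ξ L : ℝ) : Prop :=
  Filter.Tendsto
    (fun ε : ℝ => (1 / Real.pi) *
      ∫ θ in {θ : ℝ | ε ≤ |θ| ∧ |θ| ≤ Real.pi}, Real.cot (θ/2) * f (ξ - θ))
    (nhdsWithin 0 (Set.Ioi 0)) (nhds L)

theorem Real.abs_cot_half_le {θ : ℝ} (h₀ : θ ≠ 0) (hπ : |θ| ≤ Real.pi) :
    |Real.cot (θ / 2)| ≤ 2 / |θ| := by
  have key : ∀ x : ℝ, 0 < x → x ≤ Real.pi → |Real.cot (x / 2)| ≤ 2 / x := by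
    intro x hx hxπ
    have hsin : 0 < Real.sin (x / 2) :=
      Real.sin_pos_of_pos_of_lt_pi (by linarith) (by linarith)
    have hcos : 0 ≤ Real.cos (x / 2) :=
      Real.cos_nonneg_of_neg_pi_div_two_le_of_le (by linarith) (by linarith)
    rw [Real.cot_eq_cos_div_sin, abs_of_nonneg (by positivity), div_le_div_iff₀ hsin hx]
    rcases hxπ.lt_or_eq with hlt | rfl
    · have h := Real.lt_tan (x := x / 2) (by linarith) (by linarith)
      have hc : 0 < Real.cos (x / 2) := Real.cos_pos_of_mem_Ioo ⟨by linarith, by linarith⟩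
      rw [Real.tan_eq_sin_div_cos, lt_div_iff₀ hc] at h
      linarith
    · simp
  rcases lt_or_gt_of_ne h₀ with hneg | hpos
  · rw [abs_of_neg hneg] at hπ ⊢
    have h := key (-θ) (by linarith) hπ
    rwa [neg_div, Real.cot_eq_cos_div_sin, Real.cos_neg, Real.sin_neg, div_neg, abs_neg,
      ← Real.cot_eq_cos_div_sin] at h
  · rw [abs_of_pos hpos] at hπ ⊢
    exact key θ hpos hπ

theorem Real.measurable_cot : Measurable Real.cot := by
  have h : Real.cot = fun x => Real.cos x / Real.sin x := funext Real.cot_eq_cos_div_sin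
  rw [h]
  fun_prop

theorem measurableSet_abs_annulus (a b : ℝ) : MeasurableSet {θ : ℝ | a ≤ |θ| ∧ |θ| ≤ b} :=
  (measurableSet_le measurable_const measurable_norm).inter
    (measurableSet_le measurable_norm measurable_const)

theorem integrableOn_cot_half_annulus {ε : ℝ} (hε : 0 < ε) :
    IntegrableOn (fun θ : ℝ => Real.cot (θ / 2)) {θ : ℝ | ε ≤ |θ| ∧ |θ| ≤ Real.pi} := by
  have hfin : volume {θ : ℝ | ε ≤ |θ| ∧ |θ| ≤ Real.pi} < ⊤ :=
    (measure_mono fun θ hθ => abs_le.1 hθ.2).trans_lt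
      (measure_Icc_lt_top (a := -Real.pi) (b := Real.pi))
  refine IntegrableOn.of_bound hfin
    (Real.measurable_cot.comp (measurable_id.div_const 2)).aestronglyMeasurable (2 / ε) ?_
  filter_upwards [ae_restrict_mem (measurableSet_abs_annulus ε Real.pi)] with θ hθ
  have hθ₀ : 0 < |θ| := hε.trans_le hθ.1
  exact (Real.abs_cot_half_le (abs_pos.1 hθ₀) hθ.2).trans
    (div_le_div_of_nonneg_left (by norm_num) hε hθ.1)

theorem integral_cot_half_annulus (ε : ℝ) :
    ∫ θ in {θ : ℝ | ε ≤ |θ| ∧ |θ| ≤ Real.pi}, Real.cot (θ / 2) = 0 := by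
  rw [← integral_indicator (measurableSet_abs_annulus ε Real.pi)]
  set F := Set.indicator {θ : ℝ | ε ≤ |θ| ∧ |θ| ≤ Real.pi} fun θ => Real.cot (θ / 2) with hF
  have hodd : ∀ θ, F (-θ) = -F θ := by
    intro θ
    simp only [hF, Set.indicator_apply, Set.mem_ofPred_eq, abs_neg]
    split_ifs
    · rw [neg_div, Real.cot_eq_cos_div_sin, Real.cos_neg, Real.sin_neg, div_neg,
        ← Real.cot_eq_cos_div_sin]
    · simp
  have h := integral_neg_eq_self F volume
  simp_rw [hodd, integral_neg] at h
  linarith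

theorem integral_indicator_abs_rpow {α R : ℝ} (hα : 0 < α) (hR : 0 ≤ R) :
    ∫ θ : ℝ, (Set.Iic R).indicator (fun x => x ^ (α - 1)) |θ| = 2 * (R ^ α / α) := by
  rw [integral_comp_abs, setIntegral_indicator measurableSet_Iic, Set.Ioi_inter_Iic,
    ← intervalIntegral.integral_of_le hR, integral_rpow (Or.inl (by linarith)), sub_add_cancel,
    Real.zero_rpow hα.ne', sub_zero]

theorem integrable_indicator_abs_rpow {α R : ℝ} (hα : 0 < α) (hR : 0 < R) :
    Integrable fun θ : ℝ => (Set.Iic R).indicator (fun x => x ^ (α - 1)) |θ| := by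
  refine Integrable.of_integral_ne_zero ?_
  rw [integral_indicator_abs_rpow hα hR.le]
  positivity

theorem continuous_of_abs_sub_le_rpow {α K : ℝ} (hα : 0 < α) {f : ℝ → ℝ}
    (hf : ∀ s t : ℝ, |f s - f t| ≤ K * |s - t| ^ α) : Continuous f := by
  refine continuous_iff_continuousAt.2 fun t => tendsto_iff_dist_tendsto_zero.2 ?_
  have hcont : Continuous fun s : ℝ => K * |s - t| ^ α :=
    continuous_const.mul
      ((continuous_id.sub continuous_const).abs.rpow_const fun _ => Or.inr hα.le)
  have hlim := hcont.tendsto t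
  simp only [sub_self, abs_zero, Real.zero_rpow hα.ne', mul_zero] at hlim
  exact squeeze_zero (fun _ => dist_nonneg) (fun s => hf s t) hlim

theorem abs_cot_half_mul_sub_le {α K : ℝ} {f : ℝ → ℝ}
    (hf : ∀ s t : ℝ, |f s - f t| ≤ K * |s - t| ^ α) (ξ : ℝ) {θ : ℝ} (h₀ : θ ≠ 0)
    (hπ : |θ| ≤ Real.pi) :
    |Real.cot (θ / 2) * (f (ξ - θ) - f ξ)| ≤ 2 * K * |θ| ^ (α - 1) := by
  have hθ : 0 < |θ| := abs_pos.2 h₀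
  have hfθ : |f (ξ - θ) - f ξ| ≤ K * |θ| ^ α := by simpa using hf (ξ - θ) ξ
  calc |Real.cot (θ / 2) * (f (ξ - θ) - f ξ)|
      = |Real.cot (θ / 2)| * |f (ξ - θ) - f ξ| := abs_mul _ _
    _ ≤ 2 / |θ| * (K * |θ| ^ α) :=
        mul_le_mul (Real.abs_cot_half_le h₀ hπ) hfθ (abs_nonneg _) (by positivity)
    _ = 2 * K * |θ| ^ (α - 1) := by
        rw [Real.rpow_sub_one hθ.ne']
        ring

/-- Existence and quantitative bound for the circle Hilbert transform of a `2π`-periodic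
`α`-Hölder function (underlying the paper's Lemma 6.2): the principal value defining
`Hf(ξ)` exists at every `ξ`, and `|Hf(ξ)| ≤ (8/α)·K`. -/
theorem stmt_9 (α K : ℝ) (hα : α ∈ Set.Ioo (0:ℝ) 1) (hK : 0 ≤ K)
    (f : ℝ → ℝ) (hper : Function.Periodic f (2*Real.pi))
    (hholder : ∀ s t : ℝ, |f s - f t| ≤ K * |s - t| ^ α) (ξ : ℝ) :
    ∃ L : ℝ, IsHilbertTransformAt f ξ L ∧ |L| ≤ (8/α) * K := by
  obtain ⟨hα₀, hα₁⟩ := hα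
  have hπ := Real.pi_pos
  have hfc := continuous_of_abs_sub_le_rpow hα₀ hholder
  set g : ℝ → ℝ := fun θ => Real.cot (θ / 2) * (f (ξ - θ) - f ξ) with hg
  set B : ℝ → ℝ := fun θ => 2 * K * (Set.Iic Real.pi).indicator (fun x => x ^ (α - 1)) |θ| with hB
  set S : ℝ → Set ℝ := fun ε => {θ | ε ≤ |θ| ∧ |θ| ≤ Real.pi} with hS
  have hSm : ∀ ε, MeasurableSet (S ε) := fun ε => measurableSet_abs_annulus ε Real.pi
  have hgm : Measurable g :=
    (Real.measurable_cot.comp (measurable_id.div_const 2)).mul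
      ((hfc.measurable.comp (measurable_const.sub measurable_id)).sub measurable_const)
  have hBint : Integrable B := (integrable_indicator_abs_rpow hα₀ hπ).const_mul _
  have hB₀ : ∀ θ, 0 ≤ B θ := fun θ => mul_nonneg (by positivity)
    (Set.indicator_apply_nonneg fun _ => Real.rpow_nonneg (abs_nonneg θ) _)
  have hg₀ : g 0 = 0 := by simp [hg]
  have hbound : ∀ ε θ, ‖(S ε).indicator g θ‖ ≤ B θ := by
    intro ε θ
    by_cases hθ : θ ∈ S ε
    · rw [Set.indicator_of_mem hθ]
      rcases eq_or_ne θ 0 with rfl | h₀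
      · simpa [hg₀] using hB₀ 0
      · simp only [hB]
        rw [Set.indicator_of_mem (Set.mem_Iic.2 hθ.2)]
        exact abs_cot_half_mul_sub_le hholder ξ h₀ hθ.2
    · rw [Set.indicator_of_notMem hθ, norm_zero]
      exact hB₀ θ
  have hlim : Filter.Tendsto (fun ε => ∫ θ, (S ε).indicator g θ) (nhdsWithin 0 (Set.Ioi 0))
      (nhds (∫ θ, (S 0).indicator g θ)) := by
    refine tendsto_integral_filter_of_dominated_convergence B
      (Filter.Eventually.of_forall fun ε => (hgm.indicator (hSm ε)).aestronglyMeasurable)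
      (Filter.Eventually.of_forall fun ε => Filter.Eventually.of_forall (hbound ε)) hBint
      (Filter.Eventually.of_forall fun θ => tendsto_const_nhds.congr' ?_)
    rcases eq_or_ne θ 0 with rfl | h₀
    · exact Filter.Eventually.of_forall fun ε => by simp [Set.indicator_apply, hg₀]
    · filter_upwards [nhdsWithin_le_nhds (Iio_mem_nhds (abs_pos.2 h₀))] with ε hε
      simp [Set.indicator_apply, hS, le_of_lt (Set.mem_Iio.1 hε)]
  refine ⟨1 / Real.pi * ∫ θ, (S 0).indicator g θ, ?_, ?_⟩
  · refine (hlim.const_mul (1 / Real.pi)).congr' ?_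
    filter_upwards [self_mem_nhdsWithin] with ε hε
    have hgS : IntegrableOn g (S ε) := (integrable_indicator_iff (hSm ε)).1
      (hBint.mono' (hgm.indicator (hSm ε)).aestronglyMeasurable
        (Filter.Eventually.of_forall (hbound ε)))
    have hcot : IntegrableOn (fun θ => Real.cot (θ / 2) * f ξ) (S ε) :=
      (integrableOn_cot_half_annulus hε).mul_const _
    have hsplit : (fun θ => Real.cot (θ / 2) * f (ξ - θ)) =
        fun θ => g θ + Real.cot (θ / 2) * f ξ := by
      funext θ
      simp only [hg]
      ring
    rw [hsplit, integral_add hgS hcot, integral_mul_const, integral_cot_half_annulus, zero_mul,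
      add_zero, integral_indicator (hSm ε)]
  · have hle : |∫ θ, (S 0).indicator g θ| ≤ 2 * K * (2 * (Real.pi ^ α / α)) := by
      rw [← integral_indicator_abs_rpow hα₀ hπ.le, ← integral_const_mul]
      exact norm_integral_le_of_norm_le hBint (Filter.Eventually.of_forall (hbound 0))
    have hpow : Real.pi ^ α ≤ Real.pi := by
      simpa using Real.rpow_le_rpow_of_exponent_le
        (by linarith [Real.pi_gt_three] : (1 : ℝ) ≤ Real.pi) hα₁.le
    rw [abs_mul, abs_of_pos (by positivity : 0 < 1 / Real.pi)]
    calc 1 / Real.pi * |∫ θ, (S 0).indicator g θ|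
        ≤ 1 / Real.pi * (2 * K * (2 * (Real.pi / α))) := by
          refine mul_le_mul_of_nonneg_left (hle.trans ?_) (by positivity)
          gcongr
      _ = 4 / α * K := by
          field_simp
          ring
      _ ≤ 8 / α * K := by
          gcongr
          norm_num
end

section
/- For every α ∈ (0,1) and every x ∈ (0, 1/2], one has ∫₀^π cot(θ/2)·(min(x, θ))^α dθ ≥ x^α · log(1/x). -/
theorem Real.cot_half_nonneg {θ : ℝ} (h0 : 0 < θ) (hπ : θ ≤ Real.pi) : 0 ≤ Real.cot (θ / 2) := by
  rw [Real.cot_eq_cos_div_sin]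
  exact div_nonneg (Real.cos_nonneg_of_neg_pi_div_two_le_of_le (by linarith) (by linarith))
    (Real.sin_nonneg_of_nonneg_of_le_pi (by linarith) (by linarith))

theorem Real.cot_half_le_pi_div {θ : ℝ} (h0 : 0 < θ) (hπ : θ ≤ Real.pi) :
    Real.cot (θ / 2) ≤ Real.pi / θ := by
  have hs : 2 / Real.pi * (θ / 2) ≤ Real.sin (θ / 2) :=
    Real.mul_le_sin (by linarith) (by linarith)
  have hp := Real.pi_pos
  rw [show 2 / Real.pi * (θ / 2) = θ / Real.pi by field_simp] at hs
  have hpos : 0 < θ / Real.pi := by positivity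
  rw [Real.cot_eq_cos_div_sin]
  calc Real.cos (θ / 2) / Real.sin (θ / 2) ≤ 1 / (θ / Real.pi) :=
        div_le_div₀ zero_le_one (Real.cos_le_one _) hpos hs
    _ = Real.pi / θ := one_div_div _ _

theorem intervalIntegrable_cot_half_mul_min_rpow {α x : ℝ} (hα : 0 < α) (hx : 0 < x) :
    IntervalIntegrable (fun θ => Real.cot (θ / 2) * (min x θ) ^ α) MeasureTheory.volume
      0 Real.pi := by
  have hdom : IntervalIntegrable (fun θ : ℝ => Real.pi * θ ^ (α - 1)) MeasureTheory.volume
      0 Real.pi :=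
    (intervalIntegral.intervalIntegrable_rpow' (by linarith)).const_mul _
  refine hdom.mono_fun' ?_ ?_
  · simp only [Real.cot_eq_cos_div_sin]
    exact Measurable.aestronglyMeasurable (by fun_prop)
  · rw [Filter.EventuallyLE, MeasureTheory.ae_restrict_iff' measurableSet_uIoc]
    filter_upwards with θ hθ
    rw [Set.uIoc_of_le Real.pi_pos.le] at hθ
    obtain ⟨h0, hπ⟩ := hθ
    have hm : 0 ≤ min x θ := (lt_min hx h0).le
    rw [Real.norm_of_nonneg (mul_nonneg (Real.cot_half_nonneg h0 hπ) (Real.rpow_nonneg hm α))]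
    calc Real.cot (θ / 2) * (min x θ) ^ α ≤ Real.pi / θ * θ ^ α :=
          mul_le_mul (Real.cot_half_le_pi_div h0 hπ)
            (Real.rpow_le_rpow hm (min_le_right _ _) hα.le) (Real.rpow_nonneg hm α)
            (div_nonneg Real.pi_pos.le h0.le)
      _ = Real.pi * θ ^ (α - 1) := by
          rw [Real.rpow_sub_one h0.ne']
          ring

theorem integral_cot_half {x : ℝ} (hx : 0 < x) (hπ : x ≤ Real.pi) :
    ∫ θ in x..Real.pi, Real.cot (θ / 2) = -2 * Real.log (Real.sin (x / 2)) := by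
  have hsin : ∀ θ ∈ Set.uIcc x Real.pi, Real.sin (θ / 2) ≠ 0 := by
    intro θ hθ
    rw [Set.uIcc_of_le hπ] at hθ
    exact (Real.sin_pos_of_pos_of_lt_pi (by linarith [hθ.1])
      (by linarith [hθ.2, Real.pi_pos])).ne'
  have hderiv : ∀ θ ∈ Set.uIcc x Real.pi,
      HasDerivAt (fun θ => 2 * Real.log (Real.sin (θ / 2))) (Real.cot (θ / 2)) θ := by
    intro θ hθ
    refine ((((hasDerivAt_id θ).div_const 2).sin.log (hsin θ hθ)).const_mul 2).congr_deriv ?_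
    rw [Real.cot_eq_cos_div_sin]
    simp only [id]
    ring
  have hcont : ContinuousOn (fun θ => Real.cot (θ / 2)) (Set.uIcc x Real.pi) := by
    simp only [Real.cot_eq_cos_div_sin]
    exact ContinuousOn.div (by fun_prop) (by fun_prop) hsin
  rw [intervalIntegral.integral_eq_sub_of_hasDerivAt hderiv hcont.intervalIntegrable]
  simp

/-- Quantitative core of the paper's Remark 6.3 (counterexample showing the Hilbert
transform is unbounded in Hölder spaces in the parameter direction): for `α ∈ (0,1)`
and `x ∈ (0, 1/2]`, `∫₀^π cot(θ/2)·(min(x,θ))^α dθ ≥ x^α · log(1/x)`. -/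
theorem stmt_12 (α x : ℝ) (hα : α ∈ Set.Ioo (0:ℝ) 1) (hx : x ∈ Set.Ioc (0:ℝ) (1/2)) :
    x ^ α * Real.log (1/x) ≤ ∫ θ in (0:ℝ)..Real.pi, Real.cot (θ/2) * (min x θ) ^ α := by
  obtain ⟨hx0, hx1⟩ := hx
  have hxπ : x ≤ Real.pi := by linarith [Real.pi_gt_three]
  have hint := intervalIntegrable_cot_half_mul_min_rpow hα.1 hx0
  have hmem : x ∈ Set.uIcc 0 Real.pi := by
    rw [Set.uIcc_of_le Real.pi_pos.le]
    exact ⟨hx0.le, hxπ⟩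
  rw [← intervalIntegral.integral_add_adjacent_intervals
    (hint.mono_set (Set.uIcc_subset_uIcc_left hmem))
    (hint.mono_set (Set.uIcc_subset_uIcc_right hmem))]
  have hnear : 0 ≤ ∫ θ in (0:ℝ)..x, Real.cot (θ / 2) * (min x θ) ^ α := by
    rw [intervalIntegral.integral_of_le hx0.le]
    refine MeasureTheory.setIntegral_nonneg measurableSet_Ioc fun θ hθ => ?_
    exact mul_nonneg (Real.cot_half_nonneg hθ.1 (hθ.2.trans hxπ))
      (Real.rpow_nonneg (lt_min hx0 hθ.1).le α)
  have hfar : ∫ θ in x..Real.pi, Real.cot (θ / 2) * (min x θ) ^ α =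
      (-2 * Real.log (Real.sin (x / 2))) * x ^ α := by
    rw [← integral_cot_half hx0 hxπ, ← intervalIntegral.integral_mul_const]
    refine intervalIntegral.integral_congr fun θ hθ => ?_
    rw [Set.uIcc_of_le hxπ] at hθ
    simp only [min_eq_left hθ.1]
  have hlog : Real.log (Real.sin (x / 2)) ≤ Real.log x :=
    Real.log_le_log (Real.sin_pos_of_pos_of_lt_pi (by linarith) (by linarith))
      ((Real.sin_le (by linarith)).trans (by linarith))
  have hneg : Real.log x ≤ 0 := Real.log_nonpos hx0.le (by linarith)
  have hmul : Real.log (1 / x) * x ^ α ≤ (-2 * Real.log (Real.sin (x / 2))) * x ^ α := by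
    refine mul_le_mul_of_nonneg_right ?_ (Real.rpow_nonneg hx0.le α)
    rw [one_div, Real.log_inv]
    linarith
  rw [hfar]
  linarith
end

section
/- Let c₁, c₂ > 0 and let h : ℝ → ℝ be Lebesgue-measurable such that for every λ > 0 the Lebesgue measure of the set {θ ∈ [−π, π] : |h(θ)| > λ} is at most c₁·e^{−c₂·λ}. Then there exists a constant C depending only on c₁ and c₂ such that for every δ ∈ (0, 1/2], ∫_{{θ : δ ≤ |θ| ≤ π}} |h(θ)|/|θ| dθ ≤ C·( (log(1/δ))² + 1 ). -/
open MeasureTheory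

theorem lintegral_Icc_ofReal_inv {a b : ℝ} (ha : 0 < a) (hab : a ≤ b) :
    ∫⁻ x in Set.Icc a b, ENNReal.ofReal |x|⁻¹ = ENNReal.ofReal (Real.log (b / a)) := by
  have hcont : ContinuousOn (fun x : ℝ => x⁻¹) (Set.Icc a b) :=
    continuousOn_inv₀.mono fun x hx => (ha.trans_le hx.1).ne'
  have hcongr : ∫⁻ x in Set.Icc a b, ENNReal.ofReal |x|⁻¹
      = ∫⁻ x in Set.Icc a b, ENNReal.ofReal x⁻¹ :=
    setLIntegral_congr_fun measurableSet_Icc fun x hx => by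
      simp only [abs_of_pos (ha.trans_le hx.1)]
  rw [hcongr, ← ofReal_integral_eq_lintegral_ofReal hcont.integrableOn_Icc,
    integral_Icc_eq_integral_Ioc, ← intervalIntegral.integral_of_le hab,
    integral_inv_of_pos ha (ha.trans_le hab)]
  filter_upwards [ae_restrict_mem measurableSet_Icc] with x hx
  exact inv_nonneg.2 (ha.le.trans hx.1)

theorem lintegral_annulus_ofReal_inv_le {a b : ℝ} (ha : 0 < a) (hab : a ≤ b) :
    ∫⁻ x in {x : ℝ | a ≤ |x| ∧ |x| ≤ b}, ENNReal.ofReal |x|⁻¹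
      ≤ ENNReal.ofReal (2 * Real.log (b / a)) := by
  have hsub : {x : ℝ | a ≤ |x| ∧ |x| ≤ b} ⊆ Set.Icc a b ∪ Neg.neg ⁻¹' Set.Icc a b := by
    rintro x ⟨h1, h2⟩
    rcases abs_cases x with ⟨h, -⟩ | ⟨h, -⟩ <;> rw [h] at h1 h2
    · exact Or.inl ⟨h1, h2⟩
    · exact Or.inr ⟨h1, h2⟩
  have hneg : ∫⁻ x in Neg.neg ⁻¹' Set.Icc a b, ENNReal.ofReal |x|⁻¹
      = ∫⁻ x in Set.Icc a b, ENNReal.ofReal |x|⁻¹ := by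
    simpa only [abs_neg] using
      (Measure.measurePreserving_neg (volume : Measure ℝ)).setLIntegral_comp_preimage
        (measurableSet_Icc (a := a) (b := b)) (f := fun x : ℝ => ENNReal.ofReal |x|⁻¹)
        (by fun_prop)
  have hlog : 0 ≤ Real.log (b / a) := Real.log_nonneg ((one_le_div ha).2 hab)
  calc _ ≤ _ := lintegral_mono_set hsub
    _ ≤ _ := lintegral_union_le _ _ _
    _ = _ := by rw [hneg, lintegral_Icc_ofReal_inv ha hab, ← ENNReal.ofReal_add hlog hlog, two_mul]

/-- Exponential decay of the distribution function of `f` gives exponential decay of the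
integral of the excess of `f` over a level `M`. -/
theorem lintegral_excess_le {α : Type*} [MeasurableSpace α] {μ : Measure α} {f : α → ℝ}
    (hf : Measurable f) {c₁ c₂ M : ℝ} (hc₁ : 0 < c₁) (hc₂ : 0 < c₂) (hM : 0 ≤ M)
    (hdecay : ∀ t, 0 < t → μ {x | t < f x} ≤ ENNReal.ofReal (c₁ * Real.exp (-c₂ * t))) :
    ∫⁻ x, ENNReal.ofReal (max (f x - M) 0) ∂μ
      ≤ ENNReal.ofReal (c₁ / c₂ * Real.exp (-c₂ * M)) := by
  have hint : IntegrableOn (fun t : ℝ => c₁ * Real.exp (-c₂ * M) * Real.exp (-c₂ * t))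
      (Set.Ioi 0) := (integrableOn_exp_mul_Ioi (neg_lt_zero.2 hc₂) 0).const_mul _
  rw [lintegral_eq_lintegral_meas_lt μ (f := fun x => max (f x - M) 0)
    (.of_forall fun x => le_max_right _ _) (by fun_prop)]
  calc _ ≤ ∫⁻ t in Set.Ioi (0 : ℝ),
        ENNReal.ofReal (c₁ * Real.exp (-c₂ * M) * Real.exp (-c₂ * t)) := by
        refine setLIntegral_mono (by fun_prop) fun t ht => ?_
        have ht : 0 < t := ht
        rw [mul_assoc, ← Real.exp_add, ← mul_add]
        refine (measure_mono fun x hx => ?_).trans (hdecay (M + t) (by positivity))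
        have hx : t < max (f x - M) 0 := hx
        rcases lt_max_iff.1 hx with h | h
        · exact lt_sub_iff_add_lt'.1 h
        · exact absurd h ht.not_gt
    _ = _ := by
        rw [← ofReal_integral_eq_lintegral_ofReal hint (.of_forall fun t => by positivity),
          integral_const_mul, integral_exp_mul_Ioi (neg_lt_zero.2 hc₂)]
        congr 1
        simp only [mul_zero, Real.exp_zero]
        field_simp

/-- Key integral estimate in the proof of the paper's Lemma 6.8: if the level sets of a
measurable function `h` on `[-π, π]` satisfy a John–Nirenberg-type exponential decay
`|{θ ∈ [-π,π] : |h(θ)| > λ}| ≤ c₁·e^{-c₂λ}`, then the truncated singular integral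
`∫_{δ ≤ |θ| ≤ π} |h(θ)|/|θ| dθ` grows at most like `C·((log(1/δ))² + 1)`, with `C`
depending only on `c₁` and `c₂`. -/
theorem stmt_13 (c₁ c₂ : ℝ) (hc₁ : 0 < c₁) (hc₂ : 0 < c₂) :
    ∃ C : ℝ, 0 < C ∧
      ∀ h : ℝ → ℝ, Measurable h →
      (∀ lam : ℝ, 0 < lam →
        volume {θ : ℝ | θ ∈ Set.Icc (-Real.pi) Real.pi ∧ lam < |h θ|}
          ≤ ENNReal.ofReal (c₁ * Real.exp (-c₂ * lam))) →
      ∀ δ : ℝ, δ ∈ Set.Ioc (0:ℝ) (1/2) →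
        (∫⁻ θ in {θ : ℝ | δ ≤ |θ| ∧ |θ| ≤ Real.pi}, ENNReal.ofReal (|h θ| / |θ|))
          ≤ ENNReal.ofReal (C * ((Real.log (1/δ))^2 + 1)) := by
  refine ⟨(5 + c₁) / c₂, by positivity, fun h hh hdecay δ ⟨hδ, hδ2⟩ => ?_⟩
  set S : Set ℝ := {θ : ℝ | δ ≤ |θ| ∧ |θ| ≤ Real.pi} with hS
  set L := Real.log (1 / δ) with hL
  have hL0 : 0 < L := Real.log_pos (by rw [lt_div_iff₀ hδ]; linarith)
  have hpi := Real.pi_gt_three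
  have hSm : MeasurableSet S :=
    (measurableSet_le measurable_const measurable_norm).inter
      (measurableSet_le measurable_norm measurable_const)
  have hM : 0 ≤ L / c₂ := by positivity
  have hpt : ∀ θ ∈ S, ENNReal.ofReal (|h θ| / |θ|) ≤
      ENNReal.ofReal (L / c₂) * ENNReal.ofReal |θ|⁻¹
        + ENNReal.ofReal δ⁻¹ * ENNReal.ofReal (max (|h θ| - L / c₂) 0) := by
    intro θ hθ
    have hθ0 : 0 < |θ| := hδ.trans_le hθ.1
    rw [← ENNReal.ofReal_mul hM, ← ENNReal.ofReal_mul (by positivity),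
      ← ENNReal.ofReal_add (by positivity) (by positivity)]
    refine ENNReal.ofReal_le_ofReal ?_
    calc |h θ| / |θ| ≤ (L / c₂ + max (|h θ| - L / c₂) 0) / |θ| := by
          gcongr
          linarith [le_max_left (|h θ| - L / c₂) 0]
      _ = L / c₂ * |θ|⁻¹ + |θ|⁻¹ * max (|h θ| - L / c₂) 0 := by ring
      _ ≤ _ := by
          gcongr
          exact hθ.1
  have htail : ∫⁻ θ in S, ENNReal.ofReal (max (|h θ| - L / c₂) 0)
      ≤ ENNReal.ofReal (c₁ / c₂ * Real.exp (-c₂ * (L / c₂))) := by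
    refine lintegral_excess_le (f := fun θ => |h θ|) hh.abs hc₁ hc₂ hM fun t ht => ?_
    rw [Measure.restrict_apply' hSm]
    refine le_trans (measure_mono ?_) (hdecay t ht)
    exact fun θ hθ => ⟨abs_le.1 hθ.2.2, hθ.1⟩
  have hexp : Real.exp (-c₂ * (L / c₂)) = δ := by
    rw [neg_mul, mul_div_cancel₀ _ hc₂.ne', hL, one_div, Real.log_inv, neg_neg, Real.exp_log hδ]
  have hlog : Real.log (Real.pi / δ) ≤ 3 + L := by
    rw [hL, one_div, Real.log_inv, Real.log_div Real.pi_pos.ne' hδ.ne']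
    linarith [Real.log_le_sub_one_of_pos Real.pi_pos, Real.pi_le_four]
  have hlog0 : 0 ≤ Real.log (Real.pi / δ) :=
    Real.log_nonneg ((one_le_div hδ).2 (by linarith))
  calc ∫⁻ θ in S, ENNReal.ofReal (|h θ| / |θ|)
      ≤ ∫⁻ θ in S, (ENNReal.ofReal (L / c₂) * ENNReal.ofReal |θ|⁻¹
        + ENNReal.ofReal δ⁻¹ * ENNReal.ofReal (max (|h θ| - L / c₂) 0)) :=
        setLIntegral_mono' hSm hpt
    _ = ENNReal.ofReal (L / c₂) * (∫⁻ θ in S, ENNReal.ofReal |θ|⁻¹)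
        + ENNReal.ofReal δ⁻¹ * ∫⁻ θ in S, ENNReal.ofReal (max (|h θ| - L / c₂) 0) := by
        rw [lintegral_add_left (by fun_prop), lintegral_const_mul _ (by fun_prop),
          lintegral_const_mul _ (by fun_prop)]
    _ ≤ ENNReal.ofReal (L / c₂) * ENNReal.ofReal (2 * Real.log (Real.pi / δ))
        + ENNReal.ofReal δ⁻¹ * ENNReal.ofReal (c₁ / c₂ * δ) := by
        rw [hexp] at htail
        gcongr
        exact lintegral_annulus_ofReal_inv_le hδ (by linarith)
    _ = ENNReal.ofReal (L / c₂ * (2 * Real.log (Real.pi / δ)) + c₁ / c₂) := by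
        rw [← ENNReal.ofReal_mul hM, ← ENNReal.ofReal_mul (by positivity),
          ← ENNReal.ofReal_add (by positivity) (by positivity)]
        congr 2
        field_simp
    _ ≤ ENNReal.ofReal ((5 + c₁) / c₂ * (L ^ 2 + 1)) := by
        refine ENNReal.ofReal_le_ofReal ?_
        calc _ ≤ L / c₂ * (2 * (3 + L)) + c₁ / c₂ := by gcongr
          _ = (L * (2 * (3 + L)) + c₁) / c₂ := by ring
          _ ≤ ((5 + c₁) * (L ^ 2 + 1)) / c₂ := by
              gcongr
              nlinarith [sq_nonneg (L - 1), mul_nonneg hc₁.le (sq_nonneg L)]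
          _ = _ := by ring
end

section
/- Let n ≥ 1, γ ∈ (0,1], R ≥ 1, L ≥ 0, M ≥ 0, C₀ ≥ 0, and set K₀ = [−R, R]ⁿ ⊆ ℝⁿ. Let f : ℝⁿ → ℝ satisfy: f vanishes outside K₀, |f(x)| ≤ L for all x, and |f(x) − f(y)| ≤ L·|x − y|^γ for all x, y. Let g : ℝⁿ → ℝ be locally integrable, vanish outside K₀, have mean oscillation at most M over every cube, and satisfy |g_{K₀}| ≤ C₀ (the absolute value of the average of g over K₀). Then there exists a constant C depending only on n, γ, and R such that the mean oscillation of the product f·g over every cube is at most C·L·(M + C₀). -/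
open MeasureTheory

/-- The closed axis-parallel cube `∏ i [a i, a i + ℓ]` in `ℝⁿ` (with the Euclidean
metric) with corner `a` and side length `ℓ`. -/
def euclCube {n : ℕ} (a : EuclideanSpace ℝ (Fin n)) (ℓ : ℝ) :
    Set (EuclideanSpace ℝ (Fin n)) :=
  {x | ∀ i, x i ∈ Set.Icc (a i) (a i + ℓ)}

/-- The box `K₀ = [-R, R]ⁿ ⊆ ℝⁿ`. -/
def euclBox (n : ℕ) (R : ℝ) : Set (EuclideanSpace ℝ (Fin n)) :=
  {x | ∀ i, x i ∈ Set.Icc (-R) R}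

/-- The mean oscillation of `g` over a set `Q`: the average over `Q` of `|g - g_Q|`,
where `g_Q` is the average of `g` over `Q` (with respect to Lebesgue measure). -/
noncomputable def meanOscillation {n : ℕ} (g : EuclideanSpace ℝ (Fin n) → ℝ)
    (Q : Set (EuclideanSpace ℝ (Fin n))) : ℝ :=
  ⨍ x in Q, |g x - ⨍ y in Q, g y|

section Average

variable {α : Type*} [MeasurableSpace α] {μ : Measure α} {s t : Set α} {g : α → ℝ}

theorem setAverage_mono_of_le {h : α → ℝ} (hs : MeasurableSet s)
    (hg : IntegrableOn g s μ) (hh : IntegrableOn h s μ) (hle : ∀ x ∈ s, g x ≤ h x) :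
    ⨍ x in s, g x ∂μ ≤ ⨍ x in s, h x ∂μ := by
  rw [setAverage_eq, setAverage_eq, smul_eq_mul, smul_eq_mul]
  exact mul_le_mul_of_nonneg_left (setIntegral_mono_on hg hh hs hle) (by positivity)

theorem setAverage_add_const (hs0 : μ s ≠ 0) (hs : μ s ≠ ⊤) (hg : IntegrableOn g s μ) (c : ℝ) :
    ⨍ x in s, (g x + c) ∂μ = (⨍ x in s, g x ∂μ) + c := by
  have hpos : μ.real s ≠ 0 := (ENNReal.toReal_pos hs0 hs).ne'
  rw [setAverage_eq, setAverage_eq, integral_add hg (integrableOn_const hs), setIntegral_const]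
  simp only [smul_eq_mul]
  field_simp

theorem abs_setAverage_sub_le (hs0 : μ s ≠ 0) (hs : μ s ≠ ⊤) (hg : IntegrableOn g s μ) (c : ℝ) :
    |(⨍ x in s, g x ∂μ) - c| ≤ ⨍ x in s, |g x - c| ∂μ := by
  have h := setAverage_add_const hs0 hs hg (-c)
  rw [sub_eq_add_neg, ← h, setAverage_eq, setAverage_eq, smul_eq_mul, smul_eq_mul, abs_mul,
    abs_of_nonneg (by positivity : 0 ≤ (μ.real s)⁻¹)]
  exact mul_le_mul_of_nonneg_left abs_integral_le_integral_abs (by positivity)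

theorem setAverage_abs_sub_average_le (hsm : MeasurableSet s) (hs0 : μ s ≠ 0) (hs : μ s ≠ ⊤)
    (hg : IntegrableOn g s μ) (c : ℝ) :
    ⨍ x in s, |g x - ⨍ y in s, g y ∂μ| ∂μ ≤ 2 * ⨍ x in s, |g x - c| ∂μ := by
  have hi (d : ℝ) : IntegrableOn (fun x => |g x - d|) s μ :=
    (hg.sub (integrableOn_const hs)).abs
  calc ⨍ x in s, |g x - ⨍ y in s, g y ∂μ| ∂μ
      ≤ ⨍ x in s, (|g x - c| + |(⨍ y in s, g y ∂μ) - c|) ∂μ :=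
        setAverage_mono_of_le hsm (hi _) ((hi c).add (integrableOn_const hs)) fun x _ => by
          simpa only [abs_sub_comm c] using abs_sub_le (g x) c (⨍ y in s, g y ∂μ)
    _ = (⨍ x in s, |g x - c| ∂μ) + |(⨍ y in s, g y ∂μ) - c| := setAverage_add_const hs0 hs (hi c) _
    _ ≤ 2 * ⨍ x in s, |g x - c| ∂μ := by
        linarith [abs_setAverage_sub_le hs0 hs hg c]

theorem setAverage_abs_le (hsm : MeasurableSet s) (hs0 : μ s ≠ 0) (hs : μ s ≠ ⊤)
    (hg : IntegrableOn g s μ) (c : ℝ) :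
    ⨍ x in s, |g x| ∂μ ≤ (⨍ x in s, |g x - c| ∂μ) + |c| := by
  have hi : IntegrableOn (fun x => |g x - c|) s μ := (hg.sub (integrableOn_const hs)).abs
  rw [← setAverage_add_const hs0 hs hi]
  refine setAverage_mono_of_le hsm hg.abs (hi.add (integrableOn_const hs)) fun x _ => ?_
  simpa using abs_add_le (g x - c) c

end Average

section Cube

variable {n : ℕ} {a : EuclideanSpace ℝ (Fin n)} {ℓ : ℝ}

theorem euclCube_eq_preimage (a : EuclideanSpace ℝ (Fin n)) (ℓ : ℝ) :
    euclCube a ℓ = (EuclideanSpace.equiv (Fin n) ℝ) ⁻¹'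
      Set.univ.pi fun i => Set.Icc (a i) (a i + ℓ) := by
  ext x
  simp only [euclCube, Set.mem_preimage, Set.mem_univ_pi]
  rfl

theorem isCompact_euclCube (a : EuclideanSpace ℝ (Fin n)) (ℓ : ℝ) : IsCompact (euclCube a ℓ) := by
  rw [euclCube_eq_preimage]
  exact (EuclideanSpace.equiv (Fin n) ℝ).toHomeomorph.isCompact_preimage.2
    (isCompact_univ_pi fun _ => isCompact_Icc)

theorem measurableSet_euclCube (a : EuclideanSpace ℝ (Fin n)) (ℓ : ℝ) :
    MeasurableSet (euclCube a ℓ) :=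
  (isCompact_euclCube a ℓ).measurableSet

theorem volume_euclCube (a : EuclideanSpace ℝ (Fin n)) (ℓ : ℝ) :
    volume (euclCube a ℓ) = ENNReal.ofReal ℓ ^ n := by
  have h := (EuclideanSpace.volume_preserving_symm_measurableEquiv_toLp (Fin n)).measure_preimage
    (MeasurableSet.univ_pi fun i => measurableSet_Icc (a := a i) (b := a i + ℓ)).nullMeasurableSet
  rw [volume_pi_pi] at h
  simp only [Real.volume_Icc, add_sub_cancel_left, Finset.prod_const, Finset.card_univ,
    Fintype.card_fin] at h
  rw [← h, euclCube_eq_preimage]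
  rfl

theorem volume_real_euclCube (a : EuclideanSpace ℝ (Fin n)) (hℓ : 0 < ℓ) :
    volume.real (euclCube a ℓ) = ℓ ^ n := by
  simp [Measure.real, volume_euclCube, hℓ.le]

theorem volume_euclCube_ne_zero (a : EuclideanSpace ℝ (Fin n)) (hℓ : 0 < ℓ) :
    volume (euclCube a ℓ) ≠ 0 := by
  rw [volume_euclCube]
  exact pow_ne_zero _ (ENNReal.ofReal_pos.2 hℓ).ne'

theorem volume_euclCube_ne_top (a : EuclideanSpace ℝ (Fin n)) (ℓ : ℝ) :
    volume (euclCube a ℓ) ≠ ⊤ :=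
  (isCompact_euclCube a ℓ).measure_ne_top

theorem euclBox_eq_euclCube (n : ℕ) (R : ℝ) :
    euclBox n R = euclCube (WithLp.toLp 2 fun _ => -R) (2 * R) := by
  ext x
  simp only [euclBox, euclCube, show -R + 2 * R = R by ring]

theorem norm_sub_le_of_mem_euclCube (hℓ : 0 ≤ ℓ) {x : EuclideanSpace ℝ (Fin n)}
    (hx : x ∈ euclCube a ℓ) : ‖x - a‖ ≤ √n * ℓ := by
  rw [EuclideanSpace.norm_eq]
  refine Real.sqrt_le_iff.2 ⟨by positivity, ?_⟩
  calc ∑ i, ‖(x - a) i‖ ^ 2 ≤ ∑ _i : Fin n, ℓ ^ 2 := by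
        refine Finset.sum_le_sum fun i _ => ?_
        have h := hx i
        rw [Set.mem_Icc] at h
        rw [PiLp.sub_apply, Real.norm_eq_abs, sq_abs]
        nlinarith
    _ = (√n * ℓ) ^ 2 := by
        simp [mul_pow, Real.sq_sqrt]

variable {g : EuclideanSpace ℝ (Fin n) → ℝ}

theorem MeasureTheory.LocallyIntegrable.integrableOn_euclCube
    (hg : LocallyIntegrable g volume) (a : EuclideanSpace ℝ (Fin n)) (ℓ : ℝ) :
    IntegrableOn g (euclCube a ℓ) :=
  hg.integrableOn_isCompact (isCompact_euclCube a ℓ)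

theorem abs_average_sub_average_double_le (hg : LocallyIntegrable g volume)
    (a : EuclideanSpace ℝ (Fin n)) (hℓ : 0 < ℓ) :
    |(⨍ x in euclCube a ℓ, g x) - ⨍ x in euclCube a (2 * ℓ), g x| ≤
      2 ^ n * meanOscillation g (euclCube a (2 * ℓ)) := by
  refine (abs_setAverage_sub_le (volume_euclCube_ne_zero a hℓ) (volume_euclCube_ne_top a ℓ)
    (hg.integrableOn_euclCube a ℓ) _).trans ?_
  set c := ⨍ x in euclCube a (2 * ℓ), g x with hc
  have hsub : euclCube a ℓ ⊆ euclCube a (2 * ℓ) := fun x hx i =>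
    ⟨(hx i).1, (hx i).2.trans (by linarith)⟩
  have hi : IntegrableOn (fun x => |g x - c|) (euclCube a (2 * ℓ)) :=
    ((hg.integrableOn_euclCube a _).sub
      (integrableOn_const (volume_euclCube_ne_top a _))).abs
  rw [meanOscillation, ← hc, setAverage_eq, setAverage_eq, volume_real_euclCube a hℓ,
    volume_real_euclCube a (by positivity), smul_eq_mul, smul_eq_mul, mul_pow, mul_inv,
    mul_assoc ((2 : ℝ) ^ n)⁻¹, mul_inv_cancel_left₀ (by positivity)]
  refine mul_le_mul_of_nonneg_left ?_ (by positivity)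
  exact setIntegral_mono_set hi (ae_of_all _ fun _ => abs_nonneg _) hsub.eventuallyLE

/-- The average of a function supported in a cube over another cube is controlled by the ratio
of the volumes. -/
theorem abs_average_le_of_support_subset {b : EuclideanSpace ℝ (Fin n)} {r : ℝ} (hr : 0 < r)
    (hg : LocallyIntegrable g volume) (hsupp : ∀ x, x ∉ euclCube b r → g x = 0)
    (a : EuclideanSpace ℝ (Fin n)) (hℓ : 0 < ℓ) :
    |⨍ x in euclCube a ℓ, g x| ≤
      (r / ℓ) ^ n * (meanOscillation g (euclCube b r) + |⨍ x in euclCube b r, g x|) := by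
  have hint : Integrable g := (integrableOn_iff_integrable_of_support_subset
    (fun x hx => by_contra fun h => hx (hsupp x h))).1 (hg.integrableOn_euclCube b r)
  have h1 := setAverage_abs_le (measurableSet_euclCube b r) (volume_euclCube_ne_zero b hr)
    (volume_euclCube_ne_top b r) (hg.integrableOn_euclCube b r) (⨍ x in euclCube b r, g x)
  have h2 : ∫ x in euclCube a ℓ, |g x| ≤ ∫ x in euclCube b r, |g x| := by
    rw [setIntegral_eq_integral_of_forall_compl_eq_zero (s := euclCube b r)
      fun x hx => by rw [hsupp x hx, abs_zero]]
    exact setIntegral_le_integral hint.abs (ae_of_all _ fun _ => abs_nonneg _)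
  have h3 : |⨍ x in euclCube a ℓ, g x| ≤ ⨍ x in euclCube a ℓ, |g x| := by
    simpa using abs_setAverage_sub_le (volume_euclCube_ne_zero a hℓ) (volume_euclCube_ne_top a ℓ)
      (hg.integrableOn_euclCube a ℓ) 0
  refine h3.trans (le_trans ?_ (mul_le_mul_of_nonneg_left h1 (by positivity)))
  rw [setAverage_eq, setAverage_eq, volume_real_euclCube a hℓ, volume_real_euclCube b hr,
    smul_eq_mul, smul_eq_mul, div_pow, div_eq_inv_mul, mul_assoc, mul_inv_cancel_left₀ (by positivity)]
  exact mul_le_mul_of_nonneg_left h2 (by positivity)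

/-- The averages of a compactly supported BMO function over cubes grow slower than any negative
power of the side length. -/
theorem rpow_mul_abs_average_le {b : EuclideanSpace ℝ (Fin n)} {r γ M C₀ : ℝ} (hn : 1 ≤ n)
    (hγ : γ ∈ Set.Ioc (0 : ℝ) 1) (hr : 0 < r) (hM : 0 ≤ M) (hC₀ : 0 ≤ C₀)
    (hg : LocallyIntegrable g volume) (hsupp : ∀ x, x ∉ euclCube b r → g x = 0)
    (hosc : ∀ (a : EuclideanSpace ℝ (Fin n)) (ℓ : ℝ), 0 < ℓ →
      meanOscillation g (euclCube a ℓ) ≤ M)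
    (havg : |⨍ x in euclCube b r, g x| ≤ C₀) (a : EuclideanSpace ℝ (Fin n)) (hℓ : 0 < ℓ) :
    ℓ ^ γ * |⨍ x in euclCube a ℓ, g x| ≤
      (r ^ n + 2 ^ n / (1 - 2 ^ (-γ))) * (M + C₀) := by
  have hθ : (2 : ℝ) ^ (-γ) < 1 := Real.rpow_lt_one_of_one_lt_of_neg (by norm_num) (by linarith [hγ.1])
  have hθ' : 0 < 1 - (2 : ℝ) ^ (-γ) := by linarith
  have large {ℓ : ℝ} (h1 : 1 ≤ ℓ) : ℓ ^ γ * |⨍ x in euclCube a ℓ, g x| ≤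
      (r ^ n + 2 ^ n / (1 - 2 ^ (-γ))) * (M + C₀) := by
    have hpos : 0 < ℓ := by linarith
    have hpow : ℓ ^ γ ≤ ℓ ^ n := by
      rw [← Real.rpow_natCast]
      exact Real.rpow_le_rpow_of_exponent_le h1 (hγ.2.trans (by exact_mod_cast hn))
    calc ℓ ^ γ * |⨍ x in euclCube a ℓ, g x|
        ≤ ℓ ^ n * ((r / ℓ) ^ n * (M + C₀)) := by
          refine mul_le_mul hpow ?_ (abs_nonneg _) (by positivity)
          refine (abs_average_le_of_support_subset hr hg hsupp a hpos).trans ?_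
          exact mul_le_mul_of_nonneg_left (add_le_add (hosc b r hr) havg) (by positivity)
      _ = r ^ n * (M + C₀) := by
          rw [← mul_assoc, ← mul_pow, mul_div_cancel₀ _ hpos.ne']
      _ ≤ _ := by
          refine mul_le_mul_of_nonneg_right (le_add_of_nonneg_right ?_) (by positivity)
          positivity
  have scales (k : ℕ) : ∀ ℓ : ℝ, 0 < ℓ → 1 ≤ 2 ^ k * ℓ → ℓ ^ γ * |⨍ x in euclCube a ℓ, g x| ≤
      (r ^ n + 2 ^ n / (1 - 2 ^ (-γ))) * (M + C₀) := by
    induction k with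
    | zero => exact fun ℓ _ h => large (by simpa using h)
    | succ k ih =>
      intro ℓ hℓ h
      rcases le_total 1 ℓ with h1 | h1
      · exact large h1
      have hd := ih (2 * ℓ) (by positivity) (by rwa [← mul_assoc, ← pow_succ])
      have hstep := (abs_average_sub_average_double_le hg a hℓ).trans
        (mul_le_mul_of_nonneg_left (hosc a (2 * ℓ) (by positivity)) (by positivity))
      have htri : |⨍ x in euclCube a ℓ, g x| ≤
          2 ^ n * M + |⨍ x in euclCube a (2 * ℓ), g x| := by
        linarith [abs_sub_abs_le_abs_sub (⨍ x in euclCube a ℓ, g x)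
          (⨍ x in euclCube a (2 * ℓ), g x)]
      have hscale : ℓ ^ γ = 2 ^ (-γ) * (2 * ℓ) ^ γ := by
        rw [Real.mul_rpow (by norm_num) hℓ.le, ← mul_assoc, ← Real.rpow_add (by norm_num)]
        simp
      have hle : ℓ ^ γ ≤ 1 := Real.rpow_le_one hℓ.le h1 hγ.1.le
      set B := (r ^ n + 2 ^ n / (1 - 2 ^ (-γ))) * (M + C₀) with hB
      have hfix : 2 ^ n * M ≤ (1 - 2 ^ (-γ)) * B := by
        have : (1 - 2 ^ (-γ)) * B = ((1 - 2 ^ (-γ)) * r ^ n + 2 ^ n) * (M + C₀) := by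
          rw [hB]
          field_simp
        rw [this]
        refine mul_le_mul (le_add_of_nonneg_left (by positivity)) (by linarith) hM (by positivity)
      calc ℓ ^ γ * |⨍ x in euclCube a ℓ, g x|
          ≤ ℓ ^ γ * (2 ^ n * M + |⨍ x in euclCube a (2 * ℓ), g x|) :=
            mul_le_mul_of_nonneg_left htri (by positivity)
        _ = ℓ ^ γ * (2 ^ n * M) +
              2 ^ (-γ) * ((2 * ℓ) ^ γ * |⨍ x in euclCube a (2 * ℓ), g x|) := by
            rw [mul_add, ← mul_assoc (2 ^ (-γ)), ← hscale]
        _ ≤ 1 * (2 ^ n * M) + 2 ^ (-γ) * B := by gcongr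
        _ ≤ B := by linarith
  obtain ⟨k, hk⟩ := pow_unbounded_of_one_lt ℓ⁻¹ (one_lt_two : (1 : ℝ) < 2)
  refine scales k ℓ hℓ ?_
  have := mul_le_mul_of_nonneg_right hk.le hℓ.le
  rwa [inv_mul_cancel₀ hℓ.ne'] at this

end Cube

theorem continuous_of_abs_sub_le_rpow_s14 {E : Type*} [SeminormedAddCommGroup E] {f : E → ℝ} {L γ : ℝ}
    (hγ : 0 < γ) (hf : ∀ x y, |f x - f y| ≤ L * ‖x - y‖ ^ γ) : Continuous f := by
  refine continuous_iff_continuousAt.2 fun y => ?_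
  rw [ContinuousAt, tendsto_iff_dist_tendsto_zero]
  refine squeeze_zero (fun _ => dist_nonneg) (fun x => hf x y) ?_
  have : Continuous fun x : E => L * ‖x - y‖ ^ γ :=
    continuous_const.mul ((continuous_id.sub continuous_const).norm.rpow_const
      fun _ => Or.inr hγ.le)
  simpa [Real.zero_rpow hγ.ne'] using this.tendsto y

/-- The paper's product lemma for BMO functions (Lemma 6.7): multiplication by a
compactly supported Hölder function maps BMO bounds to BMO bounds; the constant `C`
depends only on `n`, `γ` and `R`. -/
theorem stmt_14 (n : ℕ) (hn : 1 ≤ n) (γ R : ℝ)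
    (hγ : γ ∈ Set.Ioc (0:ℝ) 1) (hR : 1 ≤ R) :
    ∃ C : ℝ, 0 < C ∧
      ∀ L M C₀ : ℝ, 0 ≤ L → 0 ≤ M → 0 ≤ C₀ →
      ∀ f g : EuclideanSpace ℝ (Fin n) → ℝ,
        (∀ x, x ∉ euclBox n R → f x = 0) →
        (∀ x, |f x| ≤ L) →
        (∀ x y, |f x - f y| ≤ L * ‖x - y‖ ^ γ) →
        LocallyIntegrable g volume →
        (∀ x, x ∉ euclBox n R → g x = 0) →
        (∀ (a : EuclideanSpace ℝ (Fin n)) (ℓ : ℝ), 0 < ℓ →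
          meanOscillation g (euclCube a ℓ) ≤ M) →
        |⨍ x in euclBox n R, g x| ≤ C₀ →
        ∀ (a : EuclideanSpace ℝ (Fin n)) (ℓ : ℝ), 0 < ℓ →
          meanOscillation (fun x => f x * g x) (euclCube a ℓ) ≤ C * L * (M + C₀) := by
  have hγ0 : 0 < γ := hγ.1
  have hθ : 0 < 1 - (2 : ℝ) ^ (-γ) :=
    sub_pos.2 (Real.rpow_lt_one_of_one_lt_of_neg (by norm_num) (by linarith))
  set A : ℝ := (2 * R) ^ n + 2 ^ n / (1 - 2 ^ (-γ)) with hA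
  have hA0 : 0 ≤ A := by positivity
  refine ⟨2 * (1 + √n ^ γ * A), by positivity, ?_⟩
  intro L M C₀ hL hM hC₀ f g _ hfL hf hg hg0 hosc havg a ℓ hℓ
  rw [euclBox_eq_euclCube] at hg0 havg
  have hgrow := rpow_mul_abs_average_le hn hγ (by positivity) hM hC₀ hg hg0 hosc havg a hℓ
  rw [← hA] at hgrow
  have hQ := measurableSet_euclCube a ℓ
  have hQ0 := volume_euclCube_ne_zero a hℓ
  have hQtop := volume_euclCube_ne_top a ℓ
  have hgQ := hg.integrableOn_euclCube a ℓ
  have hfg : IntegrableOn (fun x => f x * g x) (euclCube a ℓ) :=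
    hgQ.continuousOn_mul (continuous_of_abs_sub_le_rpow_s14 hγ0 hf).continuousOn
      (isCompact_euclCube a ℓ)
  have hoscQ := hosc a ℓ hℓ
  rw [meanOscillation] at hoscQ ⊢
  set c := ⨍ x in euclCube a ℓ, g x
  refine (setAverage_abs_sub_average_le hQ hQ0 hQtop hfg (f a * c)).trans ?_
  have hpt : ∀ x ∈ euclCube a ℓ,
      |f x * g x - f a * c| ≤ L * |g x - c| + L * (√n ^ γ * (A * (M + C₀))) := by
    intro x hx
    have hfx : |f x - f a| ≤ L * (√n ^ γ * ℓ ^ γ) := by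
      rw [← Real.mul_rpow (by positivity) hℓ.le]
      refine (hf x a).trans (mul_le_mul_of_nonneg_left ?_ hL)
      exact Real.rpow_le_rpow (norm_nonneg _) (norm_sub_le_of_mem_euclCube hℓ.le hx) hγ0.le
    calc |f x * g x - f a * c| = |f x * (g x - c) + (f x - f a) * c| := by ring_nf
      _ ≤ |f x| * |g x - c| + |f x - f a| * |c| := by
          rw [← abs_mul, ← abs_mul]
          exact abs_add_le _ _
      _ ≤ L * |g x - c| + L * (√n ^ γ * ℓ ^ γ) * |c| := by
          gcongr
          exact hfL x
      _ = L * |g x - c| + L * (√n ^ γ * (ℓ ^ γ * |c|)) := by ring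
      _ ≤ _ := by gcongr
  have hi : IntegrableOn (fun x => |g x - c|) (euclCube a ℓ) :=
    (hgQ.sub (integrableOn_const hQtop)).abs
  have hLi : IntegrableOn (fun x => L * |g x - c|) (euclCube a ℓ) := hi.const_mul L
  have hmean : ⨍ x in euclCube a ℓ, |f x * g x - f a * c| ≤
      ⨍ x in euclCube a ℓ, (L * |g x - c| + L * (√n ^ γ * (A * (M + C₀)))) :=
    setAverage_mono_of_le hQ (hfg.sub (integrableOn_const hQtop)).abs
      (hLi.add (integrableOn_const hQtop)) hpt
  rw [setAverage_add_const hQ0 hQtop hLi,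
    show ⨍ x in euclCube a ℓ, L * |g x - c| = L * ⨍ x in euclCube a ℓ, |g x - c| by
      simp only [setAverage_eq, smul_eq_mul, integral_const_mul]; ring] at hmean
  have h1 := mul_le_mul_of_nonneg_left hoscQ hL
  have h2 := mul_nonneg hL hC₀
  calc 2 * ⨍ x in euclCube a ℓ, |f x * g x - f a * c|
      ≤ 2 * (L * M + L * C₀ + L * (√n ^ γ * (A * (M + C₀)))) := by
        refine mul_le_mul_of_nonneg_left (hmean.trans ?_) (by norm_num)
        linarith
    _ = 2 * (1 + √n ^ γ * A) * L * (M + C₀) := by ring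
end
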